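/- Let n ≥ 2, let M be a matroid on [n], and let 0 < q ≤ 1. Then for every 0 < m < n and every w ∈ ℝ^n with all coordinates nonnegative, Z^m_M(q, w)² / C(n,m)² ≥ (Z^{m+1}_M(q, w) / C(n,m+1)) · (Z^{m−1}_M(q, w) / C(n,m−1)), where C(n,k) denotes the binomial coefficient. -/

import Mathlib

open MvPolynomial Finset

/-- Rank-function axioms for a matroid on `[n]` (Oxley, Theorem 1.3.2). -/
def IsMatroidRank (n : ℕ) (rk : Finset (Fin n) → ℕ) : Prop :=
  (∀ A, rk A ≤ A.card) ∧
  (∀ A B, A ⊆ B → rk A ≤ rk B) ∧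
  (∀ A B : Finset (Fin n), rk (A ∪ B) + rk (A ∩ B) ≤ rk A + rk B)

/-- `Z^k_M(q, w)`. -/
noncomputable def Zk (n : ℕ) (q : ℝ) (rk : Finset (Fin n) → ℕ) (k : ℕ) :
    MvPolynomial (Fin n) ℝ :=
  ∑ A ∈ Finset.powersetCard k (Finset.univ : Finset (Fin n)),
    C (q ^ (-(rk A : ℤ))) * ∏ i ∈ A, X i

open scoped Matrix

/-- A symmetric matrix is nonpositive on every vector orthogonal to all its eigenvectors with
positive eigenvalue. -/
theorem dotProduct_mulVec_nonpos_of_eigenvector {κ : Type*} [Fintype κ] [DecidableEq κ]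
    (M : Matrix κ κ ℝ) (hM : M.IsHermitian) (z : κ → ℝ)
    (h : ∀ (l : ℝ) (v : κ → ℝ), v ⬝ᵥ v = 1 → M *ᵥ v = l • v → 0 < l → v ⬝ᵥ z = 0) :
    z ⬝ᵥ M *ᵥ z ≤ 0 := by
  have key := hM.eigenvectorBasis.sum_inner_mul_inner (WithLp.toLp 2 z) (WithLp.toLp 2 (M *ᵥ z))
  simp only [EuclideanSpace.inner_eq_star_dotProduct, star_trivial] at key
  rw [dotProduct_comm, ← key]
  refine Finset.sum_nonpos fun i _ => ?_
  set v : κ → ℝ := (hM.eigenvectorBasis i).ofLp with hv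
  have hMv : M *ᵥ v = hM.eigenvalues i • v := hM.mulVec_eigenvectorBasis i
  have hvv : v ⬝ᵥ v = 1 := by
    have := hM.eigenvectorBasis.inner_eq_one i
    rwa [EuclideanSpace.inner_eq_star_dotProduct, star_trivial] at this
  have hswap : M *ᵥ z ⬝ᵥ v = hM.eigenvalues i * (v ⬝ᵥ z) := by
    rw [dotProduct_comm, Matrix.dotProduct_mulVec, ← Matrix.mulVec_transpose]
    have : Mᵀ = M := (Matrix.conjTranspose_eq_transpose_of_trivial M).symm.trans hM
    rw [this, hMv, smul_dotProduct, smul_eq_mul]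
  rw [hswap]
  rcases le_or_gt (hM.eigenvalues i) 0 with hl | hl
  · nlinarith [mul_self_nonneg (v ⬝ᵥ z)]
  · rw [h _ v hvv hMv hl]; simp

/-- Bochner's method. -/
theorem sum_nonpos_of_bochner {κ : Type*} [Fintype κ]
    (H : κ → κ → ℝ) (w h : κ → ℝ) (o : κ) (hsymm : ∀ i j, H i j = H j i)
    (hnn : ∀ i j, 0 ≤ H i j) (hw : ∀ i, 0 < w i) (hh : ∀ i, h i = ∑ j, H i j * w j)
    (hconn : ∀ j, 0 < H o j ∨ ∀ i, H i j = 0)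
    (hboch : ∀ x : κ → ℝ, ∑ i, ∑ j, x i * H i j * x j ≤
      ∑ k, w k * (∑ j, H k j * x j) ^ 2 / h k)
    (x : κ → ℝ) (hx : ∑ k, h k * x k = 0) :
    ∑ i, ∑ j, x i * H i j * x j ≤ 0 := by
  classical
  have hh0 : ∀ i, 0 ≤ h i := fun i => by
    rw [hh]; exact Finset.sum_nonneg fun j _ => mul_nonneg (hnn _ _) (hw _).le
  have hz : ∀ i, h i = 0 → ∀ j, H i j = 0 := fun i hi j => by
    rw [hh, Finset.sum_eq_zero_iff_of_nonneg
      (fun j _ => mul_nonneg (hnn _ _) (hw _).le)] at hi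
    exact (mul_eq_zero.mp (hi j (mem_univ j))).resolve_right (hw j).ne'
  set s : κ → ℝ := fun i => √(h i / w i) with hs
  have hs2 : ∀ i, s i * s i = h i / w i := fun i =>
    Real.mul_self_sqrt (div_nonneg (hh0 i) (hw i).le)
  have hs0 : ∀ i, s i = 0 → h i = 0 := fun i hi => by
    have := hs2 i
    rw [hi, mul_zero, eq_comm, div_eq_zero_iff] at this
    exact this.resolve_right (hw i).ne'
  have hsr : ∀ i, s i = 0 → ∀ j, H i j = 0 := fun i hi => hz i (hs0 i hi)
  set M : Matrix κ κ ℝ := Matrix.of fun i j => H i j / (s i * s j) with hMdef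
  have hM : M.IsHermitian := by
    ext i j
    simp [hMdef, hsymm i j, mul_comm]
  have hcancel : ∀ i j, s i * (H i j / (s i * s j)) * s j = H i j := fun i j => by
    by_cases hi : s i = 0
    · simp [hi, hsr i hi]
    by_cases hj : s j = 0
    · simp [hj, hsymm i j, hsr j hj]
    field_simp
  have hform : ∑ i, ∑ j, x i * H i j * x j =
      (fun i => s i * x i) ⬝ᵥ M *ᵥ (fun i => s i * x i) := by
    simp only [dotProduct, Matrix.mulVec, hMdef, Matrix.of_apply, Finset.mul_sum]
    refine Finset.sum_congr rfl fun i _ => Finset.sum_congr rfl fun j _ => ?_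
    conv_lhs => rw [← hcancel i j]
    ring
  rw [hform]
  refine dotProduct_mulVec_nonpos_of_eigenvector M hM _ fun l v hvv hMv hl => ?_
  -- the generalized eigenvector `H y = l D y`
  set y : κ → ℝ := fun i => v i / s i with hy
  have hMi : ∀ i, ∑ j, H i j / (s i * s j) * v j = l * v i := fun i => by
    have := congrFun hMv i
    simpa [Matrix.mulVec, dotProduct, hMdef] using this
  have hvs : ∀ i, v i = s i * y i := fun i => by
    by_cases hi : s i = 0
    · have := hMi i
      simp only [hi, zero_mul, div_zero, Finset.sum_const_zero] at this ⊢
      exact (mul_eq_zero.mp this.symm).resolve_left hl.ne'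
    · simp only [hy]; field_simp
  have hHy : ∀ i, ∑ j, H i j * y j = l * (h i / w i * y i) := fun i => by
    have h1 : ∑ j, H i j * y j = s i * (l * v i) := by
      rw [← hMi, Finset.mul_sum]
      refine Finset.sum_congr rfl fun j _ => ?_
      conv_lhs => rw [← hcancel i j]
      rw [hvs j]; ring
    rw [h1, hvs i, ← hs2]; ring
  have hyD : ∑ i, h i / w i * y i ^ 2 = 1 := by
    rw [← hvv]
    simp only [dotProduct]
    refine Finset.sum_congr rfl fun i _ => ?_
    rw [hvs i, ← hs2]; ring
  have hyH : ∑ i, ∑ j, y i * H i j * y j = l := by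
    calc _ = ∑ i, l * (h i / w i * y i ^ 2) := by
          refine Finset.sum_congr rfl fun i _ => ?_
          simp only [mul_assoc, ← Finset.mul_sum]
          rw [hHy]; ring
      _ = l := by rw [← Finset.mul_sum, hyD, mul_one]
  have hl1 : 1 ≤ l := by
    have h1 := hboch y
    have h2 : ∑ k, w k * (∑ j, H k j * y j) ^ 2 / h k = l ^ 2 := by
      calc _ = ∑ k, l ^ 2 * (h k / w k * y k ^ 2) := by
            refine Finset.sum_congr rfl fun k _ => ?_
            rw [hHy]
            have := (hw k).ne'
            by_cases hk : h k = 0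
            · simp [hk]
            · field_simp
        _ = l ^ 2 := by rw [← Finset.mul_sum, hyD, mul_one]
    rw [hyH, h2] at h1
    nlinarith
  -- the Dirichlet form
  have hdir : ∑ i, ∑ j, H i j * w i * w j * (y i / w i - y j / w j) ^ 2 = 2 * (1 - l) := by
    have e : ∀ i j, H i j * w i * w j * (y i / w i - y j / w j) ^ 2 =
        H i j * w j * (y i ^ 2 / w i) + H j i * w i * (y j ^ 2 / w j)
          - 2 * (y i * H i j * y j) := fun i j => by
      rw [hsymm j i]
      have := (hw i).ne'
      have := (hw j).ne'
      field_simp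
      ring
    have e1 : ∑ i, ∑ j, H i j * w j * (y i ^ 2 / w i) = 1 := by
      rw [← hyD]
      refine Finset.sum_congr rfl fun i _ => ?_
      rw [← Finset.sum_mul, ← hh]; ring
    have e2 : ∑ i, ∑ j, H j i * w i * (y j ^ 2 / w j) = 1 := by
      rw [Finset.sum_comm, e1]
    simp only [e, Finset.sum_sub_distrib, Finset.sum_add_distrib, e1, e2, ← Finset.mul_sum, hyH]
    ring
  have hterm : ∀ i j, 0 ≤ H i j * w i * w j * (y i / w i - y j / w j) ^ 2 := fun i j => by
    have := hnn i j
    have := hw i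
    have := hw j
    positivity
  have hoj : ∀ j, H o j * w o * w j * (y o / w o - y j / w j) ^ 2 = 0 := fun j => by
    have h1 : ∑ i, ∑ j, H i j * w i * w j * (y i / w i - y j / w j) ^ 2 ≤ 0 := by
      rw [hdir]; linarith
    have h2 : ∑ j, H o j * w o * w j * (y o / w o - y j / w j) ^ 2 ≤
        ∑ i, ∑ j, H i j * w i * w j * (y i / w i - y j / w j) ^ 2 :=
      Finset.single_le_sum (f := fun i => ∑ j, H i j * w i * w j * (y i / w i - y j / w j) ^ 2)
        (fun i _ => Finset.sum_nonneg fun j _ => hterm i j) (mem_univ o)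
    have h3 := Finset.single_le_sum
      (f := fun j => H o j * w o * w j * (y o / w o - y j / w j) ^ 2)
      (fun j _ => hterm o j) (mem_univ j)
    exact le_antisymm (h3.trans (h2.trans h1)) (hterm o j)
  have hprop : ∀ j, h j / w j * y j = y o / w o * h j := fun j => by
    rcases hconn j with hpos | hzero
    · have h1 := hoj j
      have : H o j * w o * w j ≠ 0 := by
        have := hw o
        have := hw j
        positivity
      have h2 := pow_eq_zero_iff (two_ne_zero) |>.mp ((mul_eq_zero.mp h1).resolve_left this)
      rw [sub_eq_zero.mp h2]; ring
    · have : h j = 0 := by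
        rw [hh]; exact Finset.sum_eq_zero fun i _ => by rw [hsymm, hzero, zero_mul]
      simp [this]
  calc v ⬝ᵥ (fun i => s i * x i) = ∑ i, y o / w o * (h i * x i) := by
        simp only [dotProduct]
        refine Finset.sum_congr rfl fun i _ => ?_
        rw [hvs i, ← mul_assoc (y o / w o), ← hprop, ← hs2]; ring
    _ = 0 := by rw [← Finset.mul_sum, hx, mul_zero]

/-- A symmetric bilinear form that is nonpositive on the orthogonal complement of a positive vector
satisfies the reverse Cauchy–Schwarz inequality at that vector. -/
theorem reverse_cauchySchwarz_of_orthogonal {V : Type*} [AddCommGroup V] [Module ℝ V]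
    (B : LinearMap.BilinForm ℝ V) (hB : ∀ x y, B x y = B y x) (w : V) (hw : 0 < B w w)
    (h : ∀ x, B w x = 0 → B x x ≤ 0) (x : V) : B x x * B w w ≤ B x w ^ 2 := by
  have h1 := h (B w w • x - B x w • w) (by
    simp only [map_sub, map_smul, smul_eq_mul, hB w x]; ring)
  simp only [map_sub, map_smul, smul_eq_mul, LinearMap.sub_apply, LinearMap.smul_apply,
    hB w x] at h1
  by_contra! h2
  nlinarith [mul_pos hw (sub_pos.mpr h2)]

/-- The reverse Cauchy–Schwarz inequality at one positive vector implies it at every other. -/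
theorem reverse_cauchySchwarz_transfer {V : Type*} [AddCommGroup V] [Module ℝ V]
    (B : LinearMap.BilinForm ℝ V) (hB : ∀ x y, B x y = B y x) (e w : V) (he : 0 < B e e)
    (hw : 0 < B w w) (h : ∀ x, B x x * B e e ≤ B x e ^ 2) (x : V) :
    B x x * B w w ≤ B x w ^ 2 := by
  have hwe : 0 < B w e ^ 2 := (mul_pos hw he).trans_le (h w)
  have h1 := h (B w e • x - B x e • w)
  simp only [map_sub, map_smul, smul_eq_mul, LinearMap.sub_apply, LinearMap.smul_apply,
    hB w x] at h1
  have h2 : B w e * (B w e * B x x - B x e * B x w) - B x e * (B w e * B x w - B x e * B w w)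
      ≤ 0 := by
    by_contra! h3
    nlinarith [mul_pos he h3]
  have h4 : B w e ^ 2 * (B x x * B w w - B x w ^ 2) ≤ 0 := by
    nlinarith [sq_nonneg (B x e * B w w - B w e * B x w), mul_nonneg hw.le (sub_nonneg.mpr h2)]
  by_contra! h5
  nlinarith [mul_pos hwe (sub_pos.mpr h5)]

/-- The Hessian of a homogeneous form satisfies the reverse Cauchy–Schwarz inequality if the
Hessians of all its partial derivatives do; `T` is the tensor of third derivatives. -/
theorem reverse_cauchySchwarz_of_derivatives {κ : Type*} [Fintype κ] [DecidableEq κ]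
    (T : κ → Matrix κ κ ℝ) (w : κ → ℝ) (o : κ) (hT1 : ∀ a b c, T a b c = T b a c)
    (hT2 : ∀ a b c, T a b c = T a c b) (hT0 : ∀ a b c, 0 ≤ T a b c) (hw : ∀ a, 0 < w a)
    (H : Matrix κ κ ℝ) (hH : ∀ a b, H a b = ∑ k, w k * T k a b)
    (hoo : 0 < H o o) (hconn : ∀ j, 0 < H o j ∨ ∀ i, H i j = 0)
    (hT : ∀ k x, Matrix.toBilin' (T k) x x * Matrix.toBilin' (T k) w w ≤
      Matrix.toBilin' (T k) x w ^ 2) (x : κ → ℝ) :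
    Matrix.toBilin' H x x * Matrix.toBilin' H w w ≤ Matrix.toBilin' H x w ^ 2 := by
  have hsymm : ∀ i j, H i j = H j i := fun i j => by simp only [hH, hT2 _ i j]
  have hnn : ∀ i j, 0 ≤ H i j := fun i j => by
    rw [hH]; exact Finset.sum_nonneg fun k _ => mul_nonneg (hw k).le (hT0 _ _ _)
  have hB : ∀ x y, Matrix.toBilin' H x y = Matrix.toBilin' H y x := fun x y => by
    simp only [Matrix.toBilin'_apply]
    rw [Finset.sum_comm]
    refine Finset.sum_congr rfl fun i _ => Finset.sum_congr rfl fun j _ => ?_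
    rw [hsymm]; ring
  have hTk : ∀ k x, Matrix.toBilin' (T k) x w = ∑ j, H k j * x j := fun k x => by
    simp only [Matrix.toBilin'_apply, hH, Finset.sum_mul]
    refine Finset.sum_congr rfl fun i _ => Finset.sum_congr rfl fun j _ => ?_
    rw [hT2 k i j, hT1 k j i]; ring
  have hHx : ∀ x, Matrix.toBilin' H x x = ∑ k, w k * Matrix.toBilin' (T k) x x := fun x => by
    simp only [Matrix.toBilin'_apply, hH, Finset.mul_sum, Finset.sum_mul]
    rw [Finset.sum_comm]
    conv_rhs => rw [Finset.sum_comm]; enter [2, i]; rw [Finset.sum_comm]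
    rw [Finset.sum_comm]
    refine Finset.sum_congr rfl fun i _ => Finset.sum_congr rfl fun j _ =>
      Finset.sum_congr rfl fun k _ => ?_
    ring
  have hpos : 0 < Matrix.toBilin' H w w := by
    have hterm : ∀ i j, 0 ≤ w i * H i j * w j := fun i j =>
      mul_nonneg (mul_nonneg (hw i).le (hnn i j)) (hw j).le
    rw [Matrix.toBilin'_apply]
    refine Finset.sum_pos' (fun i _ => Finset.sum_nonneg fun j _ => hterm i j)
      ⟨o, mem_univ o, Finset.sum_pos' (fun j _ => hterm o j) ⟨o, mem_univ o, ?_⟩⟩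
    have := hw o
    positivity
  refine reverse_cauchySchwarz_of_orthogonal _ hB w hpos (fun x hx => ?_) x
  rw [Matrix.toBilin'_apply]
  refine sum_nonpos_of_bochner H w (fun i => ∑ j, H i j * w j) o hsymm hnn hw (fun _ => rfl)
    hconn (fun x => ?_) x ?_
  · rw [← Matrix.toBilin'_apply, hHx]
    refine Finset.sum_le_sum fun k _ => ?_
    have h1 := hT k x
    rw [hTk, hTk] at h1
    rw [mul_div_assoc]
    refine mul_le_mul_of_nonneg_left ?_ (hw k).le
    have hk : 0 ≤ ∑ j, H k j * w j :=
      Finset.sum_nonneg fun j _ => mul_nonneg (hnn _ _) (hw j).le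
    rcases hk.eq_or_lt with h0 | h0
    · have hrow : ∀ j, H k j = 0 := fun j => by
        have := (Finset.sum_eq_zero_iff_of_nonneg
          (fun j _ => mul_nonneg (hnn k j) (hw j).le)).mp h0.symm j (mem_univ j)
        exact (mul_eq_zero.mp this).resolve_right (hw j).ne'
      have hTz : ∀ i j, T k i j = 0 := fun i j => by
        have h2 := hrow i
        rw [hH, Finset.sum_eq_zero_iff_of_nonneg
          (fun l _ => mul_nonneg (hw l).le (hT0 _ _ _))] at h2
        have := (mul_eq_zero.mp (h2 j (mem_univ j))).resolve_left (hw j).ne'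
        rwa [hT1, hT2] at this
      rw [← h0, div_zero, Matrix.toBilin'_apply]
      exact le_of_eq (Finset.sum_eq_zero fun i _ => Finset.sum_eq_zero fun j _ => by
        rw [hTz]; ring)
    · rwa [le_div_iff₀ h0]
  · rw [← hx, Matrix.toBilin'_apply, Finset.sum_comm]
    refine Finset.sum_congr rfl fun i _ => ?_
    rw [Finset.sum_mul]
    refine Finset.sum_congr rfl fun j _ => ?_
    rw [hsymm]; ring

/-- The partial derivative on set functions: `none` acts trivially, and `some i` contracts `i`. -/
def contractAt {ι : Type*} [DecidableEq ι] (a : Option ι) (φ : Finset ι → ℝ) (S : Finset ι) : ℝ :=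
  match a with
  | none => φ S
  | some i => if i ∈ S then 0 else φ (insert i S)

/-- The value at `w` of the degree `d` form whose iterated derivatives are the values of `c`. -/
def iteratedForm {ι : Type*} [Fintype ι] [DecidableEq ι] (c : Finset ι → ℝ) (w : Option ι → ℝ) :
    ℕ → Finset ι → ℝ
  | 0 => c
  | d + 1 => fun S => ∑ a, w a * contractAt a (iteratedForm c w d) S

section

variable {ι : Type*} [DecidableEq ι]

theorem contractAt_comm (a b : Option ι) (φ : Finset ι → ℝ) :
    contractAt a (contractAt b φ) = contractAt b (contractAt a φ) := by
  ext S
  rcases a with _ | i <;> rcases b with _ | j <;> simp only [contractAt]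
  by_cases hij : i = j
  · simp [hij]
  · simp only [Finset.mem_insert, hij, Ne.symm hij, false_or, Finset.insert_comm i j]
    split_ifs <;> rfl

theorem contractAt_sum {κ : Type*} [Fintype κ] (a : Option ι) (w : κ → ℝ)
    (φ : κ → Finset ι → ℝ) :
    contractAt a (fun S => ∑ k, w k * φ k S) = fun S => ∑ k, w k * contractAt a (φ k) S := by
  ext S
  rcases a with _ | i <;> simp only [contractAt]
  split_ifs <;> simp

theorem contractAt_nonneg (a : Option ι) (φ : Finset ι → ℝ) (h : ∀ S, 0 ≤ φ S) (S : Finset ι) :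
    0 ≤ contractAt a φ S := by
  rcases a with _ | i <;> simp only [contractAt]
  · exact h S
  · split_ifs
    · rfl
    · exact h _

variable [Fintype ι]

theorem iteratedForm_pos (c : Finset ι → ℝ) (hc : ∀ S, 0 < c S) (w : Option ι → ℝ)
    (hw : ∀ a, 0 < w a) (d : ℕ) (S : Finset ι) : 0 < iteratedForm c w d S := by
  induction d generalizing S with
  | zero => exact hc S
  | succ d ih =>
    exact Finset.sum_pos' (fun a _ => mul_nonneg (hw a).le
      (contractAt_nonneg a _ (fun S => (ih S).le) S))
      ⟨none, mem_univ _, mul_pos (hw none) (ih S)⟩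

/-- The Hessian of a form with derivatives `φ`. -/
def contractHessian (φ : Finset ι → ℝ) (S : Finset ι) : Matrix (Option ι) (Option ι) ℝ :=
  fun a b => contractAt a (contractAt b φ) S

theorem toBilin'_contractHessian_comm (φ : Finset ι → ℝ) (S : Finset ι) (x y : Option ι → ℝ) :
    Matrix.toBilin' (contractHessian φ S) x y = Matrix.toBilin' (contractHessian φ S) y x := by
  simp only [Matrix.toBilin'_apply, contractHessian]
  rw [Finset.sum_comm]
  refine Finset.sum_congr rfl fun i _ => Finset.sum_congr rfl fun j _ => ?_
  rw [contractAt_comm]; ring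

theorem reverse_cauchySchwarz_iteratedForm (c : Finset ι → ℝ) (hc : ∀ S, 0 < c S)
    (w : Option ι → ℝ) (hw : ∀ a, 0 < w a)
    (hbase : ∀ S : Finset ι, #S + 2 ≤ Fintype.card ι → ∀ x,
      Matrix.toBilin' (contractHessian c S) x x * Matrix.toBilin' (contractHessian c S) w w ≤
        Matrix.toBilin' (contractHessian c S) x w ^ 2)
    (d : ℕ) (S : Finset ι) (hS : #S + d + 2 ≤ Fintype.card ι) (x : Option ι → ℝ) :
    Matrix.toBilin' (contractHessian (iteratedForm c w d) S) x x *
      Matrix.toBilin' (contractHessian (iteratedForm c w d) S) w w ≤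
        Matrix.toBilin' (contractHessian (iteratedForm c w d) S) x w ^ 2 := by
  induction d generalizing S x with
  | zero => exact hbase S hS x
  | succ d ih =>
    have hpos := iteratedForm_pos c hc w hw
    refine reverse_cauchySchwarz_of_derivatives
      (fun k a b => contractAt k (contractAt a (contractAt b (iteratedForm c w d))) S) w none
      (fun a b e => by rw [contractAt_comm]) (fun a b e => by rw [contractAt_comm b e])
      (fun a b e => ?_) hw _ (fun a b => ?_) (hpos _ _) (fun j => ?_) (fun k y => ?_) x
    · exact contractAt_nonneg _ _ (contractAt_nonneg _ _ (contractAt_nonneg _ _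
        fun S => (hpos d S).le)) S
    · simp only [contractHessian, iteratedForm, contractAt_sum]
      refine Finset.sum_congr rfl fun k _ => ?_
      rw [contractAt_comm b k, contractAt_comm a k]
    · rcases j with _ | i
      · exact Or.inl (hpos _ _)
      · by_cases hi : i ∈ S
        · refine Or.inr fun a => ?_
          rw [contractHessian, contractAt_comm]
          simp [contractAt, hi]
        · left
          simpa [contractHessian, contractAt, hi] using hpos (d + 1) (insert i S)
    · rcases k with _ | i
      · exact ih S (by omega) y
      · by_cases hi : i ∈ S
        · have e : (fun a b => contractAt (some i)
              (contractAt a (contractAt b (iteratedForm c w d))) S) =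
              (0 : Matrix (Option ι) (Option ι) ℝ) := by
            ext a b
            simp [contractAt, hi]
          rw [e]
          simp
        · have h := ih (insert i S) (by rw [Finset.card_insert_of_notMem hi]; omega) y
          have e : (fun a b => contractAt (some i)
              (contractAt a (contractAt b (iteratedForm c w d))) S) =
              contractHessian (iteratedForm c w d) (insert i S) := by
            ext a b
            simp [contractHessian, contractAt, hi]
          rw [e]
          exact h

/-- The Euler relations turn reverse Cauchy–Schwarz into log-concavity. -/
theorem iteratedForm_logConcave (c : Finset ι → ℝ) (hc : ∀ S, 0 < c S)
    (w : Option ι → ℝ) (hw : ∀ a, 0 < w a)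
    (hbase : ∀ S : Finset ι, #S + 2 ≤ Fintype.card ι → ∀ x,
      Matrix.toBilin' (contractHessian c S) x x * Matrix.toBilin' (contractHessian c S) w w ≤
        Matrix.toBilin' (contractHessian c S) x w ^ 2)
    (d : ℕ) (S : Finset ι) (hS : #S + d + 2 ≤ Fintype.card ι) :
    iteratedForm c w d S * iteratedForm c w (d + 2) S ≤ iteratedForm c w (d + 1) S ^ 2 := by
  have h := reverse_cauchySchwarz_iteratedForm c hc w hw hbase d S hS (Pi.single none 1)
  have e1 : Matrix.toBilin' (contractHessian (iteratedForm c w d) S) (Pi.single none 1)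
      (Pi.single none 1) = iteratedForm c w d S := by
    rw [Matrix.toBilin'_single]; rfl
  have e2 : Matrix.toBilin' (contractHessian (iteratedForm c w d) S) (Pi.single none 1) w =
      iteratedForm c w (d + 1) S := by
    rw [Matrix.toBilin'_apply, Finset.sum_eq_single none (by simp +contextual) (by simp)]
    simp only [iteratedForm]
    refine Finset.sum_congr rfl fun a _ => ?_
    simp [contractHessian, contractAt, mul_comm]
  have e3 : Matrix.toBilin' (contractHessian (iteratedForm c w d) S) w w =
      iteratedForm c w (d + 2) S := by
    rw [Matrix.toBilin'_apply]
    simp only [iteratedForm, contractAt_sum, Finset.mul_sum]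
    refine Finset.sum_congr rfl fun a _ => Finset.sum_congr rfl fun b _ => ?_
    rw [contractHessian]; ring
  rwa [e1, e2, e3] at h

end

/-- The inequality behind the signature of a rank two matroid whose parallel classes are the
fibers of `f`. -/
theorem card_mul_sum_le_of_fibers {ι γ : Type*} [DecidableEq ι] [DecidableEq γ] (U : Finset ι)
    (f : ι → γ) (q : ℝ) (hq0 : 0 ≤ q) (hq1 : q ≤ 1) (y : ι → ℝ) :
    (#U : ℝ) * ∑ i ∈ U, ∑ j ∈ U, (if i = j then 0 else if f i = f j then q else 1) * (y i * y j) ≤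
      (#U - 1 : ℝ) * (∑ i ∈ U, y i) ^ 2 := by
  have h1 : (∑ i ∈ U, y i) ^ 2 ≤ #U * ∑ i ∈ U, y i ^ 2 := sq_sum_le_card_mul_sum_sq
  have h2 : (∑ i ∈ U, y i) ^ 2 ≤
      #U * ∑ i ∈ U, ∑ j ∈ U, (if f i = f j then y i * y j else 0) := by
    have hfib : ∑ k ∈ U.image f, ∑ i ∈ U with f i = k, y i = ∑ i ∈ U, y i :=
      Finset.sum_fiberwise_of_maps_to (fun i hi => Finset.mem_image_of_mem f hi) y
    have hsq : ∑ k ∈ U.image f, (∑ i ∈ U with f i = k, y i) ^ 2 =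
        ∑ i ∈ U, ∑ j ∈ U, (if f i = f j then y i * y j else 0) := by
      rw [← Finset.sum_fiberwise_of_maps_to (t := U.image f)
        (fun i hi => Finset.mem_image_of_mem f hi)]
      refine Finset.sum_congr rfl fun k _ => ?_
      rw [sq, Finset.sum_mul_sum]
      refine Finset.sum_congr rfl fun i hi => ?_
      rw [(Finset.mem_filter.mp hi).2, Finset.sum_filter]
      simp only [eq_comm]
    rw [← hfib, ← hsq]
    refine sq_sum_le_card_mul_sum_sq.trans (mul_le_mul_of_nonneg_right ?_
      (Finset.sum_nonneg fun _ _ => sq_nonneg _))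
    exact_mod_cast Finset.card_image_le
  have h3 : ∑ i ∈ U, ∑ j ∈ U, (if i = j then 0 else if f i = f j then q else 1) * (y i * y j) =
      (∑ i ∈ U, y i) ^ 2 - q * ∑ i ∈ U, y i ^ 2 -
        (1 - q) * ∑ i ∈ U, ∑ j ∈ U, (if f i = f j then y i * y j else 0) := by
    have e : ∀ i j, (if i = j then 0 else if f i = f j then q else 1) * (y i * y j) =
        y i * y j - q * (if i = j then y i * y j else 0) -
          (1 - q) * (if f i = f j then y i * y j else 0) := fun i j => by
      by_cases hij : i = j
      · subst hij; simp; ring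
      · by_cases hf : f i = f j <;> simp [hij, hf]
        ring
    simp only [e, Finset.sum_sub_distrib, ← Finset.mul_sum]
    congr 2
    · rw [sq, Finset.sum_mul_sum]; simp only [Finset.mul_sum]
    · congr 1
      refine Finset.sum_congr rfl fun i hi => ?_
      rw [Finset.sum_ite_eq, if_pos hi, sq]
  rw [h3]
  nlinarith [mul_le_mul_of_nonneg_left h1 hq0,
    mul_le_mul_of_nonneg_left h2 (sub_nonneg.mpr hq1)]

section

variable {n : ℕ} {rk : Finset (Fin n) → ℕ}

theorem IsMatroidRank.insert_le (hrk : IsMatroidRank n rk) (S : Finset (Fin n)) (i : Fin n) :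
    rk (insert i S) ≤ rk S + 1 := by
  have h1 := hrk.2.2 {i} S
  have h2 := hrk.1 {i}
  rw [Finset.card_singleton] at h2
  rw [← Finset.insert_eq] at h1
  omega

theorem IsMatroidRank.le_insert (hrk : IsMatroidRank n rk) (S : Finset (Fin n)) (i : Fin n) :
    rk S ≤ rk (insert i S) :=
  hrk.2.1 _ _ (Finset.subset_insert _ _)

theorem IsMatroidRank.insert_insert_le (hrk : IsMatroidRank n rk) (S : Finset (Fin n))
    (i j : Fin n) :
    rk (insert i (insert j S)) + rk S ≤ rk (insert i S) + rk (insert j S) := by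
  have h1 := hrk.2.2 (insert i S) (insert j S)
  have h2 := hrk.2.1 S (insert i S ∩ insert j S)
    (Finset.subset_inter (Finset.subset_insert _ _) (Finset.subset_insert _ _))
  have e : insert i S ∪ insert j S = insert i (insert j S) := by
    ext; simp; tauto
  rw [e] at h1
  omega

/-- Equality or parallelism in the contraction by `S`. -/
def parallelSetoid (hrk : IsMatroidRank n rk) (S : Finset (Fin n)) : Setoid (Fin n) where
  r i j := i = j ∨ (rk (insert i S) = rk S + 1 ∧ rk (insert j S) = rk S + 1 ∧
    rk (insert i (insert j S)) = rk S + 1)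
  iseqv := by
    refine ⟨fun i => Or.inl rfl, ?_, ?_⟩
    · rintro i j (rfl | ⟨h1, h2, h3⟩)
      · exact Or.inl rfl
      · exact Or.inr ⟨h2, h1, by rwa [Finset.insert_comm]⟩
    · rintro i j k (rfl | ⟨h1, h2, h3⟩) h
      · exact h
      rcases h with rfl | ⟨h4, h5, h6⟩
      · exact Or.inr ⟨h1, h2, h3⟩
      refine Or.inr ⟨h1, h5, ?_⟩
      have h7 := hrk.insert_insert_le (insert j S) i k
      have h8 := hrk.2.1 (insert i (insert k S)) (insert i (insert k (insert j S)))
        (Finset.insert_subset_insert _ (Finset.insert_subset_insert _ (Finset.subset_insert _ _)))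
      have h9 := hrk.le_insert (insert k S) i
      rw [Finset.insert_comm k j] at h7 h8
      omega

theorem IsMatroidRank.zpow_mul_zpow (hrk : IsMatroidRank n rk) (S : Finset (Fin n)) {q : ℝ}
    (hq : 0 < q) {i j : Fin n} (hij : i ≠ j)
    [Decidable ((Quotient.mk (parallelSetoid hrk S) i) = Quotient.mk (parallelSetoid hrk S) j)] :
    q ^ (-(rk (insert i (insert j S)) : ℤ)) * q ^ (-(rk S : ℤ)) =
      (if Quotient.mk (parallelSetoid hrk S) i = Quotient.mk (parallelSetoid hrk S) j
        then q else 1) * (q ^ (-(rk (insert i S) : ℤ)) * q ^ (-(rk (insert j S) : ℤ))) := by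
  have hiff : Quotient.mk (parallelSetoid hrk S) i = Quotient.mk (parallelSetoid hrk S) j ↔
      (rk (insert i S) = rk S + 1 ∧ rk (insert j S) = rk S + 1 ∧
        rk (insert i (insert j S)) = rk S + 1) := by
    rw [Quotient.eq]
    exact or_iff_right hij
  have h1 := hrk.insert_le S i
  have h2 := hrk.insert_le S j
  have h3 := hrk.le_insert S i
  have h4 := hrk.le_insert S j
  have h5 := hrk.insert_insert_le S i j
  have h6 := hrk.le_insert (insert j S) i
  have h7 := hrk.le_insert (insert i S) j
  rw [Finset.insert_comm] at h7
  have hq' := hq.ne'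
  by_cases h : rk (insert i S) = rk S + 1 ∧ rk (insert j S) = rk S + 1 ∧
      rk (insert i (insert j S)) = rk S + 1
  · rw [if_pos (hiff.mpr h), ← zpow_add₀ hq', ← zpow_add₀ hq', ← zpow_one_add₀ hq']
    congr 1
    omega
  · rw [if_neg (mt hiff.mp h), one_mul, ← zpow_add₀ hq', ← zpow_add₀ hq']
    congr 1
    omega

/-- The coefficients of the homogenized Potts model partition function, in divided power form. -/
noncomputable def pottsCoeff (n : ℕ) (q : ℝ) (rk : Finset (Fin n) → ℕ) (S : Finset (Fin n)) : ℝ :=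
  (n - #S).factorial * q ^ (-(rk S : ℤ))

theorem pottsCoeff_quadratic_le (hrk : IsMatroidRank n rk) {q : ℝ} (hq0 : 0 < q) (hq1 : q ≤ 1)
    (S : Finset (Fin n)) (hS : #S + 2 ≤ n) (x : Fin n → ℝ) :
    (∑ i, ∑ j, x i * contractHessian (pottsCoeff n q rk) S (some i) (some j) * x j) *
      pottsCoeff n q rk S ≤ (∑ i, x i * contractAt (some i) (pottsCoeff n q rk) S) ^ 2 := by
  classical
  obtain ⟨k, hk⟩ : ∃ k, n = #S + (k + 2) := ⟨n - #S - 2, by omega⟩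
  set f := Quotient.mk (parallelSetoid hrk S)
  set y : Fin n → ℝ := fun i => q ^ (-(rk (insert i S) : ℤ)) * x i with hy
  have hcard : (#Sᶜ : ℝ) = k + 2 := by
    rw [Finset.card_compl, Fintype.card_fin, show n - #S = k + 2 by omega]; push_cast; ring
  have hL : ∑ i, x i * contractAt (some i) (pottsCoeff n q rk) S =
      (k + 1).factorial * ∑ i ∈ Sᶜ, y i := by
    rw [Finset.mul_sum, ← Finset.sum_subset (Finset.subset_univ Sᶜ)]
    · refine Finset.sum_congr rfl fun i hi => ?_
      rw [Finset.mem_compl] at hi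
      rw [contractAt, if_neg hi, pottsCoeff, Finset.card_insert_of_notMem hi,
        show n - (#S + 1) = k + 1 by omega, hy]
      ring
    · intro i _ hi
      rw [Finset.mem_compl, not_not] at hi
      simp [contractAt, hi]
  have hQ : (∑ i, ∑ j, x i * contractHessian (pottsCoeff n q rk) S (some i) (some j) * x j) *
      pottsCoeff n q rk S = (k + 2).factorial * k.factorial *
        ∑ i ∈ Sᶜ, ∑ j ∈ Sᶜ, (if i = j then 0 else if f i = f j then q else 1) * (y i * y j) := by
    rw [Finset.mul_sum, Finset.sum_mul, ← Finset.sum_subset (Finset.subset_univ Sᶜ)]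
    · refine Finset.sum_congr rfl fun i hi => ?_
      rw [Finset.mem_compl] at hi
      rw [Finset.mul_sum, Finset.sum_mul, ← Finset.sum_subset (Finset.subset_univ Sᶜ)]
      · refine Finset.sum_congr rfl fun j hj => ?_
        rw [Finset.mem_compl] at hj
        by_cases hij : i = j
        · subst hij
          simp [contractHessian, contractAt]
        · have hm : j ∉ insert i S := by simp [hj, Ne.symm hij]
          have hz := hrk.zpow_mul_zpow S hq0 hij
          simp only [contractHessian, contractAt, if_neg hi, if_neg hm, if_neg hij, pottsCoeff,
            Finset.card_insert_of_notMem hi, Finset.card_insert_of_notMem hm, hy]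
          rw [show n - (#S + 1 + 1) = k by omega, show n - #S = k + 2 by omega,
            Finset.insert_comm j i]
          linear_combination (x i * x j * (k + 2).factorial * k.factorial) * hz
      · intro j _ hj
        rw [Finset.mem_compl, not_not] at hj
        simp [contractHessian, contractAt, hj]
    · intro i _ hi
      rw [Finset.mem_compl, not_not] at hi
      simp [contractHessian, contractAt, hi]
  have hmain := card_mul_sum_le_of_fibers Sᶜ f q hq0.le hq1 y
  rw [hcard] at hmain
  rw [hL, hQ, Nat.factorial_succ (k + 1), Nat.factorial_succ k]
  push_cast
  have hfac : (0 : ℝ) ≤ (k + 1) * (k.factorial : ℝ) ^ 2 := by positivity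
  have := mul_le_mul_of_nonneg_left hmain hfac
  linarith

theorem pottsCoeff_pos {q : ℝ} (hq0 : 0 < q) (S : Finset (Fin n)) : 0 < pottsCoeff n q rk S := by
  rw [pottsCoeff]; positivity

theorem reverse_cauchySchwarz_pottsCoeff (hrk : IsMatroidRank n rk) {q : ℝ} (hq0 : 0 < q)
    (hq1 : q ≤ 1) (w : Option (Fin n) → ℝ) (hw : ∀ a, 0 < w a) (S : Finset (Fin n))
    (hS : #S + 2 ≤ n) (x : Option (Fin n) → ℝ) :
    Matrix.toBilin' (contractHessian (pottsCoeff n q rk) S) x x *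
      Matrix.toBilin' (contractHessian (pottsCoeff n q rk) S) w w ≤
        Matrix.toBilin' (contractHessian (pottsCoeff n q rk) S) x w ^ 2 := by
  set c := pottsCoeff n q rk with hc
  have hpos : ∀ S, 0 < c S := fun S => pottsCoeff_pos hq0 S
  have he : Matrix.toBilin' (contractHessian c S) (Pi.single none 1) (Pi.single none 1) = c S := by
    rw [Matrix.toBilin'_single]; rfl
  have hnn : ∀ a b, 0 ≤ contractHessian c S a b := fun a b =>
    contractAt_nonneg _ _ (contractAt_nonneg _ _ fun S => (hpos S).le) S
  refine reverse_cauchySchwarz_transfer _ (toBilin'_contractHessian_comm c S) (Pi.single none 1) w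
    (by rw [he]; exact hpos S) ?_ (fun z => ?_) x
  · have hterm : ∀ i j, 0 ≤ w i * contractHessian c S i j * w j := fun i j =>
      mul_nonneg (mul_nonneg (hw i).le (hnn i j)) (hw j).le
    rw [Matrix.toBilin'_apply]
    exact Finset.sum_pos' (fun i _ => Finset.sum_nonneg fun j _ => hterm i j)
      ⟨none, Finset.mem_univ _, Finset.sum_pos' (fun j _ => hterm none j)
        ⟨none, Finset.mem_univ _, mul_pos (mul_pos (hw none) (hpos S)) (hw none)⟩⟩
  · have h1 : Matrix.toBilin' (contractHessian c S) z (Pi.single none 1) =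
        z none * c S + ∑ i, z (some i) * contractAt (some i) c S := by
      refine Eq.trans ?_ (Fintype.sum_option (fun a => z a * contractAt a c S))
      rw [Matrix.toBilin'_apply]
      refine Finset.sum_congr rfl fun a _ => ?_
      rw [Finset.sum_eq_single none (by simp +contextual) (by simp)]
      simp only [contractHessian, Pi.single_eq_same, mul_one]
      rfl
    have h2 : Matrix.toBilin' (contractHessian c S) z z =
        z none ^ 2 * c S + 2 * z none * ∑ i, z (some i) * contractAt (some i) c S +
          ∑ i, ∑ j, z (some i) * contractHessian c S (some i) (some j) * z (some j) := by
      have e1 : ∀ i, contractHessian c S none (some i) = contractAt (some i) c S := fun _ => rfl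
      have e2 : ∀ i, contractHessian c S (some i) none = contractAt (some i) c S := fun _ => rfl
      have e3 : contractHessian c S none none = c S := rfl
      simp only [Matrix.toBilin'_apply, Fintype.sum_option, e1, e2, e3, Finset.sum_add_distrib,
        Finset.mul_sum]
      have e4 : ∀ i, 2 * z none * (z (some i) * contractAt (some i) c S) =
          z none * contractAt (some i) c S * z (some i) +
            z (some i) * contractAt (some i) c S * z none := fun i => by ring
      simp only [e4, Finset.sum_add_distrib]
      ring
    have h3 := pottsCoeff_quadratic_le hrk hq0 hq1 S hS (fun i => z (some i))
    rw [he, h1, h2]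
    simp only [← hc] at h3
    nlinarith

end

theorem sum_powersetCard_erase {ι : Type*} [DecidableEq ι] (U : Finset ι) (d : ℕ)
    (g : Finset ι → ℝ) :
    ∑ i ∈ U, ∑ A ∈ powersetCard d (U.erase i), g (insert i A) =
      (d + 1) * ∑ B ∈ powersetCard (d + 1) U, g B := by
  have h : (d + 1) * ∑ B ∈ powersetCard (d + 1) U, g B =
      ∑ B ∈ powersetCard (d + 1) U, ∑ _i ∈ B, g B := by
    rw [Finset.mul_sum]
    refine Finset.sum_congr rfl fun B hB => ?_
    rw [Finset.sum_const, (Finset.mem_powersetCard.mp hB).2, nsmul_eq_mul]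
    push_cast; ring
  rw [h, Finset.sum_sigma', Finset.sum_sigma']
  refine Finset.sum_bij' (fun p _ => ⟨insert p.1 p.2, p.1⟩) (fun p _ => ⟨p.2, p.1.erase p.2⟩)
    ?_ ?_ ?_ ?_ ?_
  · rintro ⟨i, A⟩ hp
    simp only [Finset.mem_sigma, Finset.mem_powersetCard, Finset.subset_erase] at hp ⊢
    obtain ⟨hi, ⟨hA, hiA⟩, hd⟩ := hp
    exact ⟨⟨Finset.insert_subset hi hA, by rw [Finset.card_insert_of_notMem hiA, hd]⟩,
      Finset.mem_insert_self _ _⟩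
  · rintro ⟨B, i⟩ hp
    simp only [Finset.mem_sigma, Finset.mem_powersetCard, Finset.subset_erase] at hp ⊢
    obtain ⟨⟨hB, hd⟩, hi⟩ := hp
    exact ⟨hB hi, ⟨(Finset.erase_subset _ _).trans hB, Finset.notMem_erase _ _⟩,
      by rw [Finset.card_erase_of_mem hi, hd]; rfl⟩
  · rintro ⟨i, A⟩ hp
    simp only [Finset.mem_sigma, Finset.mem_powersetCard, Finset.subset_erase] at hp
    simp [Finset.erase_insert hp.2.1.2]
  · rintro ⟨B, i⟩ hp
    simp only [Finset.mem_sigma] at hp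
    simp [Finset.insert_erase hp.2]
  · rintro ⟨i, A⟩ _
    rfl

theorem iteratedForm_of_none_eq_zero {ι : Type*} [Fintype ι] [DecidableEq ι] (c : Finset ι → ℝ)
    (w : Option ι → ℝ) (hw : w none = 0) (d : ℕ) (S : Finset ι) :
    iteratedForm c w d S =
      d.factorial * ∑ A ∈ powersetCard d Sᶜ, c (S ∪ A) * ∏ i ∈ A, w (some i) := by
  induction d generalizing S with
  | zero => simp [iteratedForm]
  | succ d ih =>
    simp only [iteratedForm]
    rw [Fintype.sum_option, hw, zero_mul, zero_add,
      ← Finset.sum_subset (Finset.subset_univ Sᶜ), Nat.factorial_succ]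
    · push_cast
      rw [mul_comm (d + 1 : ℝ), mul_assoc, ← sum_powersetCard_erase, Finset.mul_sum]
      refine Finset.sum_congr rfl fun i hi => ?_
      rw [Finset.mem_compl] at hi
      rw [contractAt, if_neg hi, ih, Finset.compl_insert, mul_left_comm, Finset.mul_sum]
      congr 1
      refine Finset.sum_congr rfl fun A hA => ?_
      rw [Finset.mem_powersetCard, Finset.subset_erase] at hA
      rw [Finset.prod_insert hA.1.2, Finset.insert_union, Finset.union_insert]
      ring
    · intro i _ hi
      rw [Finset.mem_compl, not_not] at hi
      simp [contractAt, hi]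

theorem continuous_iteratedForm {ι : Type*} [Fintype ι] [DecidableEq ι] (c : Finset ι → ℝ)
    (d : ℕ) (S : Finset ι) : Continuous fun w => iteratedForm c w d S := by
  induction d generalizing S with
  | zero => exact continuous_const
  | succ d ih =>
    refine continuous_finsetSum _ fun a _ => (continuous_apply a).mul ?_
    rcases a with _ | i <;> simp only [contractAt]
    · exact ih S
    · split_ifs
      · exact continuous_const
      · exact ih _

theorem iteratedForm_pottsCoeff_eq_eval_Zk {n : ℕ} (rk : Finset (Fin n) → ℕ) (q : ℝ) (w : Fin n → ℝ)
    (d : ℕ) (hd : d ≤ n) :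
    iteratedForm (pottsCoeff n q rk) (fun a => a.elim 0 w) d ∅ =
      n.factorial * (eval w (Zk n q rk d) / n.choose d) := by
  have h : eval w (Zk n q rk d) =
      ∑ A ∈ powersetCard d univ, q ^ (-(rk A : ℤ)) * ∏ i ∈ A, w i := by
    simp [Zk]
  have hch : (n.choose d : ℝ) ≠ 0 := by exact_mod_cast (Nat.choose_pos hd).ne'
  rw [iteratedForm_of_none_eq_zero _ _ rfl, Finset.compl_empty, h, mul_div_assoc',
    eq_div_iff hch, ← Nat.choose_mul_factorial_mul_factorial hd]
  push_cast
  simp only [Finset.mul_sum, Finset.sum_mul]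
  refine Finset.sum_congr rfl fun A hA => ?_
  rw [Finset.empty_union, pottsCoeff, (Finset.mem_powersetCard.mp hA).2]
  simp only [Option.elim]
  ring

theorem statement11 (n : ℕ) (hn : 2 ≤ n) (rk : Finset (Fin n) → ℕ)
    (hrk : IsMatroidRank n rk) (q : ℝ) (hq0 : 0 < q) (hq1 : q ≤ 1)
    (m : ℕ) (hm0 : 0 < m) (hmn : m < n)
    (w : Fin n → ℝ) (hw : ∀ i, 0 ≤ w i) :
    (eval w (Zk n q rk (m+1)) / (n.choose (m+1) : ℝ)) *
      (eval w (Zk n q rk (m-1)) / (n.choose (m-1) : ℝ)) ≤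
    (eval w (Zk n q rk m)) ^ 2 / ((n.choose m : ℝ)) ^ 2 := by
  obtain ⟨d, rfl⟩ : ∃ d, m = d + 1 := ⟨m - 1, by omega⟩
  set v : ℝ → Option (Fin n) → ℝ := fun ε a => a.elim 0 w + ε with hv
  set F : ℕ → ℝ → ℝ := fun k ε => iteratedForm (pottsCoeff n q rk) (v ε) k ∅ with hF
  have hcont : ∀ k, Continuous (F k) := fun k =>
    (continuous_iteratedForm _ k ∅).comp
      (continuous_pi fun a => continuous_const.add continuous_id)
  have hpos : ∀ ε ∈ Set.Ioi (0 : ℝ), F d ε * F (d + 2) ε ≤ F (d + 1) ε ^ 2 := fun ε hε => by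
    have hvpos : ∀ a, 0 < v ε a := fun a => by
      rcases a with _ | i
      · simpa [hv] using hε
      · exact add_pos_of_nonneg_of_pos (hw i) hε
    refine iteratedForm_logConcave _ (pottsCoeff_pos hq0) (v ε) hvpos (fun S hS x => ?_) d ∅ ?_
    · rw [Fintype.card_fin] at hS
      exact reverse_cauchySchwarz_pottsCoeff hrk hq0 hq1 _ hvpos S hS x
    · rw [Finset.card_empty, Fintype.card_fin]; omega
  have hlim : F d 0 * F (d + 2) 0 ≤ F (d + 1) 0 ^ 2 :=
    le_of_tendsto_of_tendsto
      ((((hcont d).mul (hcont (d + 2))).tendsto 0).mono_left nhdsWithin_le_nhds)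
      ((((hcont (d + 1)).pow 2).tendsto 0).mono_left nhdsWithin_le_nhds)
      (Filter.eventually_of_mem self_mem_nhdsWithin hpos)
  have hF0 : ∀ k ≤ n, F k 0 = n.factorial * (eval w (Zk n q rk k) / n.choose k) := fun k hk => by
    rw [← iteratedForm_pottsCoeff_eq_eval_Zk rk q w k hk]
    simp [hF, hv]
  rw [hF0 _ (by omega), hF0 _ (by omega), hF0 _ (by omega)] at hlim
  have hfac : (0 : ℝ) < (n.factorial : ℝ) ^ 2 := by positivity
  rw [← div_pow, Nat.add_sub_cancel]
  refine le_of_mul_le_mul_left ?_ hfac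
  linarith
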